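/- Lemma B.1(b), combinatorial form. Suppose the scaling satisfies λ_1(n) = o(1). Then there exists a constant C > 0 such that for all n sufficiently large and every integer u with 0 ≤ u ≤ K_{1,n}, | Σ_{i=1}^r μ_i · C(P_n − 2K_{1,n} + u, K_{i,n})/C(P_n, K_{i,n}) − (1 − 2λ_1(n) + (u/K_{1,n})·λ_1(n)) | ≤ C·λ_1(n)². Equivalently, the conditional probability that a third vertex's key ring intersects both key rings of two class-1 vertices whose key rings share exactly u keys equals (u/K_{1,n})λ_1(n) ± O(λ_1(n)²). -/

import Mathlib

open Finset Filter Real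
open scoped Classical

/-- A configuration: class assignment, key rings, channel on/off indicators. -/
abbrev Cfg (n r P : ℕ) := (Fin n → Fin r) × (Fin n → Finset (Fin P)) × (Fin n → Fin n → Bool)

/-- Adjacency in the intersection graph `H(n)`: distinct vertices sharing a key
with the channel between them on. -/
def adj {n r P : ℕ} (ω : Cfg n r P) (x y : Fin n) : Prop :=
  x ≠ y ∧ ((ω.2.1 x) ∩ (ω.2.1 y)).Nonempty ∧ ω.2.2 (min x y) (max x y) = true

/-- Degree of a vertex in `H(n)`. -/
noncomputable def deg {n r P : ℕ} (ω : Cfg n r P) (x : Fin n) : ℕ :=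
  (Finset.univ.filter (fun y => adj ω x y)).card

/-- Probability weight of a configuration: classes are i.i.d. with law `μ`,
key rings uniform over `K`-subsets given the class, channels i.i.d. Bernoulli(`α`). -/
noncomputable def wt {n r P : ℕ} (μ : Fin r → ℝ) (K : Fin r → ℕ) (α : ℝ)
    (ω : Cfg n r P) : ℝ :=
  (∏ x : Fin n, μ (ω.1 x) *
      (if (ω.2.1 x).card = K (ω.1 x) then ((P.choose (K (ω.1 x)) : ℝ))⁻¹ else 0)) *
  ∏ p ∈ Finset.univ.filter (fun p : Fin n × Fin n => p.1 < p.2),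
      (if ω.2.2 p.1 p.2 then α else 1 - α)

/-- Probability of an event under the random graph model. -/
noncomputable def Pr {n r P : ℕ} (μ : Fin r → ℝ) (K : Fin r → ℕ) (α : ℝ)
    (E : Cfg n r P → Prop) : ℝ :=
  ∑ ω : Cfg n r P, if E ω then wt μ K α ω else 0

/-- Key-graph edge probability `p_{ij}` between a class-`i` and a class-`j` node. -/
noncomputable def pEdge {r : ℕ} (Pn : ℕ) (Kn : Fin r → ℕ) (i j : Fin r) : ℝ :=
  1 - ((Pn - Kn i).choose (Kn j) : ℝ) / ((Pn.choose (Kn j) : ℝ))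

/-- Mean key-graph edge probability `λ_i` for a class-`i` node. -/
noncomputable def lam {r : ℕ} (μ : Fin r → ℝ) (Pn : ℕ) (Kn : Fin r → ℕ) (i : Fin r) : ℝ :=
  ∑ j, μ j * pEdge Pn Kn i j

/-- A decreasing convex sequence `f` with `f 0 = 1` whose increments shrink at most as fast as `f`
itself is linear on `[K, 2K]` up to a quadratic error in `1 - f K`. -/
lemma convex_decay_linear_approx (f : ℕ → ℝ) (N K t : ℕ) (hK : 0 < K) (hKN : 2 * K ≤ N)
    (ht : t ≤ K) (hf0 : f 0 = 1) (hf : ∀ j, 0 ≤ f j) (hanti : Antitone f)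
    (hconv : ∀ i j, i ≤ j → j < N → f j - f (j + 1) ≤ f i - f (i + 1))
    (hdecay : ∀ j, j < N → (f 0 - f 1) * f j ≤ f j - f (j + 1)) :
    |f (K + t) - (1 - (1 + (t : ℝ) / K) * (1 - f K))| ≤ 2 * (1 - f K) ^ 2 := by
  have hK' : (0 : ℝ) < K := by exact_mod_cast hK
  obtain ⟨p, hp⟩ : ∃ p, p = 1 - f K := ⟨_, rfl⟩
  obtain ⟨c, hc⟩ : ∃ c, c = p / K := ⟨_, rfl⟩
  have hpc : p = K * c := by rw [hc]; field_simp
  have htel : ∑ i ∈ range K, (f i - f (i + 1)) = p := by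
    rw [Finset.sum_range_sub', hf0, hp]
  have hp0 : 0 ≤ p := by
    have := hanti (Nat.zero_le K)
    rw [hp]; linarith
  have hc0 : 0 ≤ c := by rw [hc]; positivity
  have hd_le : ∀ j, K ≤ j → j < N → f j - f (j + 1) ≤ c := by
    intro j hj hjN
    have h := Finset.card_nsmul_le_sum (range K) (fun i => f i - f (i + 1)) (f j - f (j + 1))
      (fun i hi => hconv i j ((Finset.mem_range.1 hi).le.trans hj) hjN)
    rw [htel, Finset.card_range, nsmul_eq_mul] at h
    rw [hc, le_div_iff₀ hK']
    linarith
  have hd0 : c ≤ f 0 - f 1 := by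
    have h := Finset.sum_le_card_nsmul (range K) (fun i => f i - f (i + 1)) (f 0 - f 1)
      (fun i hi => hconv 0 i (Nat.zero_le i) (by have := Finset.mem_range.1 hi; omega))
    rw [htel, Finset.card_range, nsmul_eq_mul] at h
    rw [hc, div_le_iff₀ hK']
    linarith
  have hlow : ∀ s, s ≤ K → 1 - p - s * c ≤ f (K + s) := by
    intro s
    induction s with
    | zero => intro _; simp [hp]
    | succ s ih =>
      intro hs
      have h1 := ih (by omega)
      have h2 := hd_le (K + s) (by omega) (by omega)
      rw [← add_assoc]
      push_cast
      linarith
  have hupp : ∀ s, s ≤ K → f (K + s) ≤ 1 - p - s * c * (1 - 2 * p) := by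
    intro s
    induction s with
    | zero => intro _; simp [hp]
    | succ s ih =>
      intro hs
      have h1 := ih (by omega)
      have h2 := hdecay (K + s) (by omega)
      have h3 := mul_le_mul_of_nonneg_right hd0 (hf (K + s))
      have hs' : (s : ℝ) ≤ K := by exact_mod_cast (by omega : s ≤ K)
      have h4 : 1 - 2 * p ≤ f (K + s) := by
        have := hlow s (by omega)
        have := mul_le_mul_of_nonneg_right hs' hc0
        linarith
      have h5 := mul_le_mul_of_nonneg_left h4 hc0
      rw [← add_assoc]
      push_cast
      linarith
  have htK : (t : ℝ) ≤ K := by exact_mod_cast ht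
  have htc : (t : ℝ) * c ≤ p := by
    rw [hpc]; exact mul_le_mul_of_nonneg_right htK hc0
  have hlin : (1 + (t : ℝ) / K) * (1 - f K) = p + t * c := by
    rw [← hp, hc]; ring
  rw [hlin, ← hp, abs_le]
  have h1 := hlow t ht
  have h2 := hupp t ht
  have h3 := mul_le_mul_of_nonneg_right htc hp0
  constructor <;> nlinarith [sq_nonneg p]

/-- The probability that a uniform `L`-subset of a `P`-set avoids `K + t` given points is
`1 - (1 + t / K) p` up to `2 p ^ 2`, where `p` is the probability of hitting `K` given points. -/
lemma avoid_prob_linear_approx (P K L t : ℕ) (hK : 0 < K) (hL : 0 < L) (hKP : 2 * K ≤ P)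
    (hLP : L ≤ P) (ht : t ≤ K) :
    |((P - (K + t)).choose L : ℝ) / (P.choose L : ℝ) -
        (1 - (1 + (t : ℝ) / K) * (1 - ((P - K).choose L : ℝ) / (P.choose L : ℝ)))| ≤
      2 * (1 - ((P - K).choose L : ℝ) / (P.choose L : ℝ)) ^ 2 := by
  obtain ⟨l, rfl⟩ : ∃ l, L = l + 1 := ⟨L - 1, by omega⟩
  have hB : (0 : ℝ) < P.choose (l + 1) := by exact_mod_cast Nat.choose_pos hLP
  have hdiff : ∀ j, j < P → ((P - j).choose (l + 1) : ℝ) / (P.choose (l + 1) : ℝ) -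
      ((P - (j + 1)).choose (l + 1) : ℝ) / (P.choose (l + 1) : ℝ) =
      ((P - (j + 1)).choose l : ℝ) / (P.choose (l + 1) : ℝ) := by
    intro j hj
    rw [← sub_div, show P - j = (P - (j + 1)) + 1 by omega, Nat.choose_succ_succ]
    push_cast
    ring
  have habs : ∀ j, j < P → ((P : ℝ) - j) * ((P - (j + 1)).choose l : ℝ) =
      ((P - j).choose (l + 1) : ℝ) * (l + 1) := by
    intro j hj
    have h := Nat.add_one_mul_choose_eq (P - (j + 1)) l
    rw [show P - (j + 1) + 1 = P - j by omega] at h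
    rw [← Nat.cast_sub hj.le]
    exact_mod_cast h
  refine convex_decay_linear_approx
    (fun j => ((P - j).choose (l + 1) : ℝ) / (P.choose (l + 1) : ℝ)) P K t hK hKP ht
    (div_self hB.ne') (fun j => by positivity) ?_ ?_ ?_
  · intro i j hij
    exact div_le_div_of_nonneg_right
      (by exact_mod_cast Nat.choose_le_choose (l + 1) (by omega : P - j ≤ P - i)) hB.le
  · intro i j hij hj
    rw [hdiff j hj, hdiff i (by omega)]
    exact div_le_div_of_nonneg_right
      (by exact_mod_cast Nat.choose_le_choose l (by omega : P - (j + 1) ≤ P - (i + 1))) hB.le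
  · intro j hj
    have hP : 0 < P := by omega
    have hP' : (0 : ℝ) < P := by exact_mod_cast hP
    have h0 := habs 0 hP
    have hj' := habs j hj
    rw [hdiff j hj, hdiff 0 hP, div_mul_div_comm, div_le_div_iff₀ (by positivity) hB]
    simp only [Nat.cast_zero, sub_zero, Nat.sub_zero, zero_add] at h0 ⊢
    have hl : (0 : ℝ) < (l : ℝ) + 1 := by positivity
    have key : ((P - 1).choose l : ℝ) * ((P - j).choose (l + 1) : ℝ) ≤
        ((P - (j + 1)).choose l : ℝ) * (P.choose (l + 1) : ℝ) := by
      refine le_of_mul_le_mul_right ?_ hl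
      calc ((P - 1).choose l : ℝ) * ((P - j).choose (l + 1) : ℝ) * (l + 1)
          = ((P : ℝ) - j) * (((P - 1).choose l : ℝ) * (P - (j + 1)).choose l) := by
            rw [mul_assoc, ← hj']; ring
        _ ≤ P * (((P - 1).choose l : ℝ) * (P - (j + 1)).choose l) := by
            refine mul_le_mul_of_nonneg_right ?_ (by positivity)
            have : (0 : ℝ) ≤ j := Nat.cast_nonneg j
            linarith
        _ = ((P - (j + 1)).choose l : ℝ) * (P.choose (l + 1) : ℝ) * (l + 1) := by
            rw [mul_assoc _ _ ((l : ℝ) + 1), ← h0]; ring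
    linarith [mul_le_mul_of_nonneg_right key hB.le]

lemma pEdge_nonneg {r : ℕ} (P : ℕ) (K : Fin r → ℕ) (i j : Fin r) : 0 ≤ pEdge P K i j := by
  unfold pEdge
  rw [sub_nonneg]
  exact div_le_one_of_le₀
    (by exact_mod_cast Nat.choose_le_choose (K j) (Nat.sub_le P (K i))) (by positivity)

lemma mul_pEdge_le_lam {r : ℕ} (μ : Fin r → ℝ) (hμ : ∀ i, 0 < μ i) (P : ℕ) (K : Fin r → ℕ)
    (i j : Fin r) : μ j * pEdge P K i j ≤ lam μ P K i :=
  Finset.single_le_sum (f := fun j => μ j * pEdge P K i j)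
    (fun j _ => mul_nonneg (hμ j).le (pEdge_nonneg P K i j)) (Finset.mem_univ j)

/-- Lemma B.1(b), combinatorial form. -/
theorem double_intersection_with_overlap_asymp
    (r : ℕ) (hr : 0 < r) (μ : Fin r → ℝ)
    (hμpos : ∀ i, 0 < μ i) (hμsum : ∑ i, μ i = 1)
    (Kf : ℕ → Fin r → ℕ) (Pf : ℕ → ℕ) (αf : ℕ → ℝ)
    (hKmono : ∀ n, 2 ≤ n → ∀ i j : Fin r, i ≤ j → Kf n i ≤ Kf n j)
    (hK2 : ∀ n, 2 ≤ n → 2 ≤ Kf n ⟨0, hr⟩)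
    (hKP : ∀ n, 2 ≤ n → 2 * Kf n ⟨r - 1, Nat.sub_lt hr Nat.one_pos⟩ ≤ Pf n)
    (hα : ∀ n, 2 ≤ n → 0 < αf n ∧ αf n < 1)
    (hlam : Tendsto (fun n : ℕ => lam μ (Pf n) (Kf n) (⟨0, hr⟩ : Fin r)) atTop (nhds 0)) :
    ∃ C : ℝ, 0 < C ∧ ∀ᶠ n : ℕ in atTop, ∀ u : ℕ, u ≤ Kf n (⟨0, hr⟩ : Fin r) →
      |(∑ i, μ i * (((Pf n - 2 * Kf n (⟨0, hr⟩ : Fin r) + u).choose (Kf n i) : ℝ) /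
          ((Pf n).choose (Kf n i) : ℝ))) -
        (1 - 2 * lam μ (Pf n) (Kf n) (⟨0, hr⟩ : Fin r) + ((u : ℝ) / (Kf n (⟨0, hr⟩ : Fin r) : ℝ)) * lam μ (Pf n) (Kf n) (⟨0, hr⟩ : Fin r))| ≤
      C * (lam μ (Pf n) (Kf n) (⟨0, hr⟩ : Fin r)) ^ 2 := by
  have : Nonempty (Fin r) := ⟨⟨0, hr⟩⟩
  refine ⟨∑ i, 2 / μ i, Finset.sum_pos (fun i _ => div_pos two_pos (hμpos i))
    Finset.univ_nonempty, ?_⟩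
  filter_upwards [eventually_ge_atTop 2] with n hn u hu
  obtain ⟨o, ho⟩ : ∃ o : Fin r, o = ⟨0, hr⟩ := ⟨_, rfl⟩
  have hK2n := hK2 n hn
  rw [← ho] at hu hK2n ⊢
  have hKo : ∀ i, Kf n o ≤ Kf n i := fun i =>
    hKmono n hn o i (by rw [ho]; exact Nat.zero_le _)
  have hKPn : ∀ i, 2 * Kf n i ≤ Pf n := fun i =>
    (Nat.mul_le_mul_left 2 (hKmono n hn i ⟨r - 1, Nat.sub_lt hr Nat.one_pos⟩
      (Nat.le_sub_one_of_lt i.2))).trans (hKP n hn)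
  have hKpos : (0 : ℝ) < Kf n o := by exact_mod_cast (by omega : 0 < Kf n o)
  have hterm : ∀ i, |((Pf n - 2 * Kf n o + u).choose (Kf n i) : ℝ) / ((Pf n).choose (Kf n i) : ℝ) -
      (1 - (2 - (u : ℝ) / Kf n o) * pEdge (Pf n) (Kf n) o i)| ≤
        2 * pEdge (Pf n) (Kf n) o i ^ 2 := by
    intro i
    have h1 := hKo i
    have h2 := hKPn i
    have h3 := hKPn o
    have h := avoid_prob_linear_approx (Pf n) (Kf n o) (Kf n i) (Kf n o - u) (by omega)
      (by omega) h3 (by omega) (Nat.sub_le _ _)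
    rw [show Pf n - (Kf n o + (Kf n o - u)) = Pf n - 2 * Kf n o + u by omega,
      Nat.cast_sub hu, sub_div, div_self hKpos.ne'] at h
    unfold pEdge
    rwa [show (2 : ℝ) - (u : ℝ) / Kf n o = 1 + (1 - (u : ℝ) / Kf n o) by ring]
  have hsum : (1 - 2 * lam μ (Pf n) (Kf n) o + ((u : ℝ) / (Kf n o : ℝ)) * lam μ (Pf n) (Kf n) o) =
      ∑ i, μ i * (1 - (2 - (u : ℝ) / Kf n o) * pEdge (Pf n) (Kf n) o i) := by
    have : ∀ i, μ i * (1 - (2 - (u : ℝ) / Kf n o) * pEdge (Pf n) (Kf n) o i) =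
        μ i - (2 - (u : ℝ) / Kf n o) * (μ i * pEdge (Pf n) (Kf n) o i) := fun i => by ring
    simp only [this]
    rw [Finset.sum_sub_distrib, ← Finset.mul_sum, hμsum]
    unfold lam
    ring
  rw [hsum, ← Finset.sum_sub_distrib, Finset.sum_mul]
  refine (Finset.abs_sum_le_sum_abs _ _).trans (Finset.sum_le_sum fun i _ => ?_)
  rw [← mul_sub, abs_mul, abs_of_pos (hμpos i)]
  calc _ ≤ μ i * (2 * pEdge (Pf n) (Kf n) o i ^ 2) :=
        mul_le_mul_of_nonneg_left (hterm i) (hμpos i).le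
    _ = 2 / μ i * (μ i * pEdge (Pf n) (Kf n) o i) ^ 2 := by
        have := (hμpos i).ne'
        field_simp
    _ ≤ _ := by
        refine mul_le_mul_of_nonneg_left ?_ (div_pos two_pos (hμpos i)).le
        exact pow_le_pow_left₀ (mul_nonneg (hμpos i).le (pEdge_nonneg _ _ _ _))
          (mul_pEdge_le_lam μ hμpos _ _ o i) 2
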